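/- With G, n, t, k and the labeling v_1, …, v_n as in the setup: d_α > α for every integer α with k + t − 1 ≤ α < n/2. -/

import Mathlib

/-- A graph `G` is `t`-tough if `|S| ≥ t · c(G − S)` for every vertex subset `S`
whose removal leaves at least two connected components. -/
def SimpleGraph.Tough {V : Type*} [Fintype V] (t : ℚ) (G : SimpleGraph V) : Prop :=
  ∀ S : Finset V,
    2 ≤ Nat.card ((G.induce ((↑S : Set V)ᶜ)).ConnectedComponent) →
    t * (Nat.card ((G.induce ((↑S : Set V)ᶜ)).ConnectedComponent) : ℚ) ≤ (S.card : ℚ)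

/-- In a tough graph, a nonempty set `I` of vertices all of whose neighbours lie in `S`, together
with one further vertex outside `S`, gives `|I| + 1` components of `G - S`. -/
theorem SimpleGraph.Tough.mul_card_succ_le {V : Type*} [Fintype V] {G : SimpleGraph V} {t : ℚ}
    (ht : 0 ≤ t) (hG : G.Tough t) {S I : Finset V} {x : V} (hI : I.Nonempty)
    (hIS : ∀ a ∈ I, a ∉ S) (hN : ∀ a ∈ I, ∀ b, G.Adj a b → b ∈ S) (hxI : x ∉ I) (hxS : x ∉ S) :
    t * (I.card + 1) ≤ S.card := by
  classical
  let H := G.induce ((↑S : Set V)ᶜ)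
  have hmem : ∀ a ∈ insert x I, a ∈ ((↑S : Set V)ᶜ) := by
    intro a ha
    rcases Finset.mem_insert.1 ha with rfl | ha
    · simpa using hxS
    · simpa using hIS a ha
  let f : {a // a ∈ insert x I} → H.ConnectedComponent :=
    fun a => H.connectedComponentMk ⟨a.1, hmem a.1 a.2⟩
  have isolated : ∀ a b : ((↑S : Set V)ᶜ : Set V), a.1 ∈ I → H.Reachable a b → a = b := by
    rintro a b ha ⟨p⟩
    cases p with
    | nil => rfl
    | @cons _ c _ h q => exact absurd (hN _ ha _ h) c.2
  have hf : Function.Injective f := by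
    rintro ⟨a, ha⟩ ⟨b, hb⟩ hab
    have hr := SimpleGraph.ConnectedComponent.exact hab
    rcases Finset.mem_insert.1 ha with rfl | ha'
    · rcases Finset.mem_insert.1 hb with rfl | hb'
      · rfl
      · have h := congrArg Subtype.val (isolated _ _ hb' hr.symm)
        exact Subtype.ext h.symm
    · have h := congrArg Subtype.val (isolated _ _ ha' hr)
      exact Subtype.ext h
  have hcard : I.card + 1 ≤ Nat.card H.ConnectedComponent := by
    have h := Nat.card_le_card_of_injective f hf
    rwa [Nat.card_eq_fintype_card, Fintype.card_coe, Finset.card_insert_of_notMem hxI] at h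
  have hpos := hI.card_pos
  calc t * (I.card + 1) ≤ t * (Nat.card H.ConnectedComponent : ℚ) :=
        mul_le_mul_of_nonneg_left (by exact_mod_cast hcard) ht
    _ ≤ S.card := hG S (by change 2 ≤ Nat.card H.ConnectedComponent; omega)

/-- If `v 1, …, v n` lists all elements by non-decreasing `f`, and at least `m` elements have
`f`-value at most `e`, then so does `v m`. -/
theorem le_of_card_le_of_sorted {V : Type*} {f : V → ℕ} {n : ℕ} {v : ℕ → V}
    (hsurj : Set.SurjOn v (Set.Icc 1 n) Set.univ)
    (hmono : ∀ i j, 1 ≤ i → i ≤ j → j ≤ n → f (v i) ≤ f (v j))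
    {T : Finset V} {m e : ℕ} (hm : 1 ≤ m) (hT : m ≤ T.card) (he : ∀ z ∈ T, f z ≤ e) :
    f (v m) ≤ e := by
  classical
  by_contra! hlt
  have hsub : T ⊆ (Finset.Icc 1 (m - 1)).image v := by
    intro z hz
    obtain ⟨j, ⟨hj1, hjn⟩, rfl⟩ := hsurj (Set.mem_univ z)
    refine Finset.mem_image_of_mem v (Finset.mem_Icc.2 ⟨hj1, ?_⟩)
    by_contra! hmj
    have := hmono m j hm (by omega) hjn
    have := he _ hz
    omega
  have h1 := Finset.card_le_card hsub
  have h2 := Finset.card_image_le (s := Finset.Icc 1 (m - 1)) (f := v)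
  rw [Nat.card_Icc] at h2
  omega

/-- With the full setup (non-Hamiltonian `t`-closed `t`-tough graph, degree
condition, `k` minimal with `d_k ≤ k`, `k < n/2`): `d_α > α` for every
integer `α` with `k + t − 1 ≤ α < n/2`. -/
theorem degree_gt_in_range
    {V : Type*} [Fintype V] [DecidableEq V] (G : SimpleGraph V) [DecidableRel G.Adj]
    (n t : ℕ) (ht : 4 ≤ t) (hn : Fintype.card V = n) (hn3 : 3 ≤ n)
    (htough : SimpleGraph.Tough (t : ℚ) G) (hnotham : ¬ G.IsHamiltonian)
    (v : ℕ → V) (hbij : Set.BijOn v (Set.Icc 1 n) Set.univ)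
    (hmono : ∀ i j, 1 ≤ i → i ≤ j → j ≤ n → G.degree (v i) ≤ G.degree (v j))
    (hcond : ∀ i, 1 ≤ i → 2 * i < n →
      G.degree (v i) ≤ i → n - i ≤ G.degree (v (n - i + t)))
    (hclosed : ∀ a b : V, a ≠ b → ¬ G.Adj a b →
      (G.degree a : ℤ) + (G.degree b : ℤ) < (n : ℤ) - (t : ℤ))
    (k : ℕ) (hk1 : 1 ≤ k) (hk2 : 2 * k < n) (hkd : G.degree (v k) ≤ k)
    (hkmin : ∀ i, 1 ≤ i → 2 * i < n → G.degree (v i) ≤ i → k ≤ i) :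
    ∀ α : ℕ, k + t - 1 ≤ α → 2 * α < n → α < G.degree (v α) := by
  intro α
  induction α using Nat.strong_induction_on with
  | _ α ih =>
  intro hα hα2
  by_contra! hle
  have htop := hcond α (by omega) hα2 hle
  have htq : (0 : ℚ) ≤ t := Nat.cast_nonneg t
  have degree_pos : ∀ y, 0 < G.degree y := by
    intro y
    by_contra! h0
    have : Nontrivial V := Fintype.one_lt_card_iff_nontrivial.1 (by omega)
    obtain ⟨x, hx⟩ := exists_ne y
    have h := htough.mul_card_succ_le htq (S := ∅) (I := {y}) (x := x) (by simp) (by simp)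
      (by
        intro a ha b hab
        obtain rfl := Finset.mem_singleton.1 ha
        have := (G.degree_pos_iff_exists_adj a).2 ⟨b, hab⟩
        omega)
      (by simpa using hx) (by simp)
    have h' : t * (1 + 1) ≤ 0 := by exact_mod_cast h
    omega
  have universal : ∀ j, n - α + t ≤ j → j ≤ n → ∀ y, y ≠ v j → G.Adj (v j) y := by
    intro j hj hjn y hy
    by_contra hadj
    have hD := hmono (n - α + t) j (by omega) hj hjn
    have hpos := degree_pos y
    have hsum := hclosed (v j) y hy.symm hadj
    obtain ⟨e, he⟩ : ∃ e, e + t + 1 + G.degree (v j) = n :=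
      ⟨n - t - 1 - G.degree (v j), by omega⟩
    have hcard : e + t ≤ (Gᶜ.neighborFinset (v j)).card := by
      rw [SimpleGraph.card_neighborFinset_eq_degree, SimpleGraph.degree_compl]
      omega
    have hlow : ∀ z ∈ Gᶜ.neighborFinset (v j), G.degree z ≤ e := by
      intro z hz
      rw [SimpleGraph.mem_neighborFinset, SimpleGraph.compl_adj] at hz
      have := hclosed (v j) z hz.1 hz.2
      omega
    have hdeg : ∀ m, 1 ≤ m → m ≤ e + t → G.degree (v m) ≤ e := fun m hm hme =>
      le_of_card_le_of_sorted (f := fun z => G.degree z) hbij.surjOn hmono hm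
        (hme.trans hcard) hlow
    by_cases hek : k ≤ e
    · have := hdeg (e + t) (by omega) le_rfl
      have := ih (e + t) (by omega) (by omega) (by omega)
      omega
    · have := hkmin e (by omega) (by omega) (hdeg e (by omega) (by omega))
      omega
  set S := (Finset.Icc (n - α + t) n).image v with hS
  have hScard : S.card = α - t + 1 := by
    rw [hS, Finset.card_image_of_injOn, Nat.card_Icc]
    · omega
    · refine hbij.injOn.mono fun j hj => ?_
      have := Finset.mem_Icc.1 (Finset.mem_coe.1 hj)
      exact ⟨by omega, this.2⟩
  have notMem : ∀ i, 1 ≤ i → i < n - α + t → v i ∉ S := by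
    intro i hi1 hi hmem
    obtain ⟨j, hj, hji⟩ := Finset.mem_image.1 hmem
    rw [Finset.mem_Icc] at hj
    have := hbij.injOn ⟨by omega, hj.2⟩ ⟨hi1, by omega⟩ hji
    omega
  have subset_nbhd : ∀ i, 1 ≤ i → i < n - α + t → S ⊆ G.neighborFinset (v i) := by
    intro i hi1 hi s hs
    rw [SimpleGraph.mem_neighborFinset]
    have hne : v i ≠ s := fun h => notMem i hi1 hi (h ▸ hs)
    obtain ⟨j, hj, rfl⟩ := Finset.mem_image.1 hs
    rw [Finset.mem_Icc] at hj
    exact (universal j hj.1 hj.2 _ hne).symm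
  have hSk := Finset.card_le_card (subset_nbhd k hk1 (by omega))
  rw [SimpleGraph.card_neighborFinset_eq_degree] at hSk
  have hIcard : ((Finset.Icc 1 k).image v).card = k := by
    rw [Finset.card_image_of_injOn, Nat.card_Icc]
    · omega
    · refine hbij.injOn.mono fun j hj => ?_
      have := Finset.mem_Icc.1 (Finset.mem_coe.1 hj)
      exact ⟨this.1, by omega⟩
  have h := htough.mul_card_succ_le htq (S := S) (I := (Finset.Icc 1 k).image v) (x := v (k + 1))
    (Finset.card_pos.1 (by omega))
    (by
      intro a ha
      obtain ⟨i, hi, rfl⟩ := Finset.mem_image.1 ha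
      rw [Finset.mem_Icc] at hi
      exact notMem i hi.1 (by omega))
    (by
      intro a ha b hab
      obtain ⟨i, hi, rfl⟩ := Finset.mem_image.1 ha
      rw [Finset.mem_Icc] at hi
      have hd := hmono i k hi.1 hi.2 (by omega)
      rw [Finset.eq_of_subset_of_card_le (subset_nbhd i hi.1 (by omega)) (by
        rw [SimpleGraph.card_neighborFinset_eq_degree]
        omega)]
      exact (G.mem_neighborFinset _ _).2 hab)
    (by
      intro hmem
      obtain ⟨i, hi, hik⟩ := Finset.mem_image.1 hmem
      rw [Finset.mem_Icc] at hi
      have := hbij.injOn ⟨hi.1, by omega⟩ ⟨by omega, by omega⟩ hik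
      omega)
    (notMem (k + 1) (by omega) (by omega))
  rw [hIcard] at h
  have h' : t * (k + 1) ≤ S.card := by exact_mod_cast h
  have : 1 * (k + 1) ≤ t * (k + 1) := Nat.mul_le_mul_right _ (by omega)
  omega
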